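/- Let X be a finite simple graph on n vertices that is connected, regular of degree k, and not a complete graph. Then X is strongly regular (i.e., there exist parameters ℓ and μ such that X is strongly regular with parameters (n, k, ℓ, μ)) if and only if the adjacency matrix of X has exactly three distinct eigenvalues. -/

import Mathlib

open Polynomial

namespace Matrix

variable {V : Type*} [Fintype V] [DecidableEq V]

/-- The complex spectrum of a real symmetric matrix is the image of its real spectrum. -/
lemma IsSymm.spectrum_map_ofReal {A : Matrix V V ℝ} (hA : A.IsSymm) :
    spectrum ℂ (A.map Complex.ofReal) = Complex.ofReal '' spectrum ℝ A := by
  have hroot (x : ℝ) : (x : ℂ) ∈ spectrum ℂ (A.map Complex.ofReal) ↔ x ∈ spectrum ℝ A := by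
    rw [mem_spectrum_iff_isRoot_charpoly, mem_spectrum_iff_isRoot_charpoly]
    have h := charpoly_map A Complex.ofRealHom
    change (A.map Complex.ofReal).charpoly = _ at h
    rw [h]
    exact isRoot_map_iff (x := x) Complex.ofRealHom.injective
  have hH : (A.map Complex.ofReal).IsHermitian := by
    ext i j
    simp [hA.apply]
  ext z
  constructor
  · intro hz
    obtain ⟨x, -, rfl⟩ := hH.spectrum_eq_image_range ▸ hz
    exact ⟨x, (hroot x).1 hz, rfl⟩
  · rintro ⟨x, hx, rfl⟩
    exact (hroot x).2 hx

/-- A polynomial vanishing on the spectrum of a real symmetric matrix annihilates the matrix. -/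
lemma IsSymm.aeval_eq_zero_of_forall_mem_spectrum {A : Matrix V V ℝ} (hA : A.IsSymm) {p : ℝ[X]}
    (hp : ∀ x ∈ spectrum ℝ A, p.IsRoot x) : aeval A p = 0 := by
  have hA' : IsSelfAdjoint A := isHermitian_iff_isSymm.2 hA
  rw [← cfc_polynomial p A hA', cfc_congr (g := fun _ ↦ 0) fun x hx ↦ hp x hx]
  exact cfc_const_zero ℝ A

end Matrix

namespace SimpleGraph

variable {V : Type*} [Fintype V] [DecidableEq V] {X : SimpleGraph V} [DecidableRel X.Adj] {k : ℕ}

lemma IsRegularOfDegree.lapMatrix_eq (hreg : X.IsRegularOfDegree k) :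
    X.lapMatrix ℝ = (k : ℝ) • 1 - X.adjMatrix ℝ := by
  ext i j
  simp [lapMatrix, degMatrix, Matrix.diagonal_apply, Matrix.one_apply, hreg.degree_eq]

lemma IsRegularOfDegree.mem_spectrum [Nonempty V] (hreg : X.IsRegularOfDegree k) :
    (k : ℝ) ∈ spectrum ℝ (X.adjMatrix ℝ) := by
  rw [spectrum.mem_iff, Algebra.algebraMap_eq_smul_one, ← hreg.lapMatrix_eq,
    Matrix.isUnit_iff_isUnit_det, det_lapMatrix_eq_zero]
  simp

lemma Connected.apply_eq_of_lapMatrix_mul_eq_zero (hconn : X.Connected) {M : Matrix V V ℝ}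
    (hM : X.lapMatrix ℝ * M = 0) (i i' j : V) : M i j = M i' j := by
  refine (X.lapMatrix_mulVec_eq_zero_iff_forall_reachable (x := M.col j)).1 ?_ i i'
    (hconn.preconnected i i')
  ext v
  exact congrFun (congrFun hM v) j

/-- If every adjacency eigenvalue of a connected `k`-regular graph, except possibly `k`, is a root
of `p`, then `p` sends the adjacency matrix to a multiple of the all-ones matrix. -/
lemma Connected.exists_aeval_adjMatrix_eq (hconn : X.Connected) (hreg : X.IsRegularOfDegree k)
    {p : ℝ[X]} (hp : ∀ x ∈ spectrum ℝ (X.adjMatrix ℝ), x ≠ k → p.IsRoot x) :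
    ∃ c : ℝ, ∀ i j, aeval (X.adjMatrix ℝ) p i j = c := by
  set M := aeval (X.adjMatrix ℝ) p with hM
  have hzero : aeval (X.adjMatrix ℝ) ((C (k : ℝ) - Polynomial.X) * p) = 0 := by
    refine X.isSymm_adjMatrix.aeval_eq_zero_of_forall_mem_spectrum fun x hx ↦ ?_
    by_cases hxk : x = k
    · simp [hxk]
    · simp [(hp x hx hxk).eq_zero]
  have haeval : aeval (X.adjMatrix ℝ) (C (k : ℝ) - Polynomial.X) = X.lapMatrix ℝ := by
    rw [hreg.lapMatrix_eq, map_sub, aeval_C, aeval_X, Algebra.algebraMap_eq_smul_one]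
  have hleft : X.lapMatrix ℝ * M = 0 := by
    rw [← haeval, hM, ← map_mul, hzero]
  have hright : X.lapMatrix ℝ * M.transpose = 0 := by
    rw [← (X.isSymm_lapMatrix (R := ℝ)).eq, ← Matrix.transpose_mul, ← haeval, hM, ← map_mul, mul_comm p,
      hzero, Matrix.transpose_zero]
  obtain ⟨v⟩ := hconn.nonempty
  exact ⟨M v v, fun i j ↦ (hconn.apply_eq_of_lapMatrix_mul_eq_zero hleft i v j).trans
    (hconn.apply_eq_of_lapMatrix_mul_eq_zero hright j v v)⟩

lemma adjMatrix_sq_apply (i j : V) :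
    (X.adjMatrix ℝ ^ 2) i j = Fintype.card (X.commonNeighbors i j) := by
  rw [adjMatrix_pow_apply_eq_card_walk]
  exact congrArg _ (Fintype.card_congr (X.walkLengthTwoEquivCommonNeighbors i j))

/-- The adjacency matrix of a connected regular graph that is not complete has at least three
eigenvalues. -/
lemma Connected.two_lt_ncard_spectrum (hconn : X.Connected) (hreg : X.IsRegularOfDegree k)
    (hncomp : X ≠ ⊤) : 2 < (spectrum ℝ (X.adjMatrix ℝ)).ncard := by
  have := hconn.nonempty
  by_contra! hle
  have hfin : (spectrum ℝ (X.adjMatrix ℝ)).Finite := Matrix.finite_real_spectrum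
  have hcard := Set.ncard_sdiff_singleton_add_one hreg.mem_spectrum hfin
  obtain ⟨θ, hθ⟩ : ∃ θ : ℝ, spectrum ℝ (X.adjMatrix ℝ) \ {(k : ℝ)} ⊆ {θ} :=
    (Set.ncard_le_one_iff_subset_singleton hfin.sdiff).1 (by omega)
  obtain ⟨c, hc⟩ := hconn.exists_aeval_adjMatrix_eq hreg (p := Polynomial.X - C θ)
    fun x hx hxk ↦ by simp [Set.mem_singleton_iff.1 (hθ ⟨hx, hxk⟩)]
  have hoff (i j : V) (hij : i ≠ j) : (if X.Adj i j then (1 : ℝ) else 0) = c := by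
    simpa [Algebra.algebraMap_eq_smul_one, Matrix.one_apply, hij] using hc i j
  apply hncomp
  ext i j
  refine ⟨fun h ↦ h.ne, fun hij ↦ ?_⟩
  have : Nontrivial V := ⟨i, j, hij⟩
  obtain ⟨m, hm⟩ := hconn.preconnected.exists_adj_of_nontrivial i
  by_contra h
  have h₁ := hoff i m hm.ne
  have h₂ := hoff i j hij
  rw [if_pos hm] at h₁
  rw [if_neg h] at h₂
  linarith

/-- The adjacency matrix of a strongly regular graph has at most three eigenvalues. -/
lemma IsSRGWith.ncard_spectrum_le_three {n ℓ μ : ℕ} (h : X.IsSRGWith n k ℓ μ) :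
    (spectrum ℝ (X.adjMatrix ℝ)).ncard ≤ 3 := by
  set q : ℝ[X] := Polynomial.X ^ 2 - C ((ℓ : ℝ) - μ) * Polynomial.X - C ((k : ℝ) - μ) with hq
  have hJ : aeval (X.adjMatrix ℝ) q = (μ : ℝ) • Matrix.of fun _ _ ↦ 1 := by
    rw [hq, map_sub, map_sub, map_mul, map_pow, aeval_X, aeval_C, aeval_C, h.matrix_eq,
      Algebra.algebraMap_eq_smul_one, Algebra.algebraMap_eq_smul_one, smul_one_mul]
    simp only [← Nat.cast_smul_eq_nsmul ℝ]
    ext i j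
    by_cases hij : i = j
    · subst hij; simp
    · by_cases ha : X.Adj i j <;> simp [hij, ha]
  have hzero : aeval (X.adjMatrix ℝ) ((Polynomial.X - C (k : ℝ)) * q) = 0 := by
    rw [map_mul, hJ, map_sub, aeval_X, aeval_C, Algebra.algebraMap_eq_smul_one, sub_mul,
      smul_one_mul]
    ext i j
    simp [h.regular.degree_eq]
  have hdeg : ((Polynomial.X - C (k : ℝ)) * q).natDegree = 3 := by
    rw [hq]; compute_degree!
  have hne : (Polynomial.X - C (k : ℝ)) * q ≠ 0 := by
    rintro h0
    rw [h0, natDegree_zero] at hdeg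
    omega
  refine (Set.ncard_le_ncard (t := ((Polynomial.X - C (k : ℝ)) * q).roots.toFinset)
    (fun x hx ↦ ?_) (Finset.finite_toSet _)).trans ?_
  · have hx' := spectrum.subset_polynomial_aeval (X.adjMatrix ℝ)
      ((Polynomial.X - C (k : ℝ)) * q) ⟨x, hx, rfl⟩
    have : Nonempty V := by
      by_contra hV
      rw [not_nonempty_iff] at hV
      simp [spectrum.of_subsingleton] at hx
    rw [hzero, spectrum.zero_eq] at hx'
    rw [Finset.mem_coe, Multiset.mem_toFinset, mem_roots hne]
    exact hx'
  · rw [Set.ncard_coe_finset]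
    exact (Multiset.toFinset_card_le _).trans ((card_roots' _).trans hdeg.le)

lemma exists_nat_forall_eq_of_forall_cast_eq {α : Type*} {P : α → Prop} {f : α → ℕ} {c : ℝ}
    (h : ∀ a, P a → (f a : ℝ) = c) : ∃ m : ℕ, ∀ a, P a → f a = m := by
  by_cases hP : ∃ a, P a
  · obtain ⟨b, hb⟩ := hP
    exact ⟨f b, fun a ha ↦ Nat.cast_injective ((h a ha).trans (h b hb).symm)⟩
  · exact ⟨0, fun a ha ↦ (hP ⟨a, ha⟩).elim⟩

/-- A connected regular graph whose adjacency matrix has three eigenvalues is strongly regular. -/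
lemma Connected.exists_isSRGWith (hconn : X.Connected) (hreg : X.IsRegularOfDegree k)
    (hthree : (spectrum ℝ (X.adjMatrix ℝ)).ncard = 3) :
    ∃ ℓ μ : ℕ, X.IsSRGWith (Fintype.card V) k ℓ μ := by
  have := hconn.nonempty
  have hcard := Set.ncard_sdiff_singleton_add_one hreg.mem_spectrum Matrix.finite_real_spectrum
  obtain ⟨θ, τ, -, hθτ⟩ := Set.ncard_eq_two.1
    (show (spectrum ℝ (X.adjMatrix ℝ) \ {(k : ℝ)}).ncard = 2 by omega)
  obtain ⟨c, hc⟩ := hconn.exists_aeval_adjMatrix_eq hreg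
    (p := Polynomial.X ^ 2 - C (θ + τ) * Polynomial.X + C (θ * τ)) fun x hx hxk ↦ by
      have hx' : x ∈ ({θ, τ} : Set ℝ) := hθτ ▸ ⟨hx, hxk⟩
      rcases hx' with rfl | rfl <;> simp <;> ring
  have hoff (i j : V) (hij : i ≠ j) : (Fintype.card (X.commonNeighbors i j) : ℝ) =
      (θ + τ) * (if X.Adj i j then 1 else 0) + c := by
    have h := hc i j
    simp only [map_add, map_sub, map_mul, map_pow, aeval_X, aeval_C,
      Algebra.algebraMap_eq_smul_one, ← add_smul, ← mul_smul, smul_mul_assoc, one_mul,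
      Matrix.add_apply, Matrix.sub_apply, Matrix.smul_apply, adjMatrix_sq_apply, adjMatrix_apply,
      Matrix.one_apply_ne hij, smul_eq_mul, mul_zero, add_zero] at h
    linarith
  obtain ⟨ℓ, hℓ⟩ := exists_nat_forall_eq_of_forall_cast_eq (P := fun e : V × V ↦ X.Adj e.1 e.2)
    (f := fun e ↦ Fintype.card (X.commonNeighbors e.1 e.2)) (c := θ + τ + c)
    fun e he ↦ by rw [hoff _ _ he.ne, if_pos he, mul_one]
  obtain ⟨μ, hμ⟩ := exists_nat_forall_eq_of_forall_cast_eq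
    (P := fun e : V × V ↦ e.1 ≠ e.2 ∧ ¬X.Adj e.1 e.2)
    (f := fun e ↦ Fintype.card (X.commonNeighbors e.1 e.2)) (c := c)
    fun e he ↦ by rw [hoff _ _ he.1, if_neg he.2, mul_zero, zero_add]
  exact ⟨ℓ, μ, rfl, hreg, fun v w hvw ↦ hℓ (v, w) hvw, fun v w hvw ha ↦ hμ (v, w) ⟨hvw, ha⟩⟩

lemma ncard_spectrum_adjMatrix_complex :
    (spectrum ℂ (X.adjMatrix ℂ)).ncard = (spectrum ℝ (X.adjMatrix ℝ)).ncard := by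
  have hmap : X.adjMatrix ℂ = (X.adjMatrix ℝ).map Complex.ofReal := by
    ext i j
    simp [adjMatrix_apply, apply_ite Complex.ofReal]
  rw [hmap, X.isSymm_adjMatrix.spectrum_map_ofReal,
    Set.ncard_image_of_injective _ Complex.ofReal_injective]

end SimpleGraph

/-- **Shrikhande–Bhagwandas.** A connected regular graph that is not complete is strongly
regular if and only if its adjacency matrix has exactly three distinct eigenvalues. -/
theorem strongly_regular_iff_three_eigenvalues
    {V : Type*} [Fintype V] [DecidableEq V]
    (X : SimpleGraph V) [DecidableRel X.Adj] (k : ℕ)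
    (hconn : X.Connected) (hreg : X.IsRegularOfDegree k) (hncomp : X ≠ ⊤) :
    (∃ ℓ μ : ℕ, X.IsSRGWith (Fintype.card V) k ℓ μ) ↔
      (spectrum ℂ (X.adjMatrix ℂ)).ncard = 3 := by
  rw [SimpleGraph.ncard_spectrum_adjMatrix_complex]
  refine ⟨?_, hconn.exists_isSRGWith hreg⟩
  rintro ⟨ℓ, μ, h⟩
  exact le_antisymm h.ncard_spectrum_le_three (hconn.two_lt_ncard_spectrum hreg hncomp)
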